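/- Let i ∈ [f_{n+1}], and let δ_i be the number of permutations w ∈ S_n with Qind(w) = i. Write Q_i = {i_1 < i_2 < ⋯ < i_p}, and set i_0 := 1, i_{p+1} := n+1, and j_k := i_k − i_{k−1} for each k ∈ [p+1]. Then: (1) δ_i equals the number of permutations w ∈ S_n satisfying w(j) < w(j+1) for all j ∈ Q_i and w(j) > w(j+1) for all j ∈ Q_i'; (2) δ_i = (n choose j_1, j_2, …, j_{p+1}) · ∏_{k=2}^{p+1} (j_k − 1), where (n choose j_1,…,j_{p+1}) = n!/(j_1! j_2! ⋯ j_{p+1}!) is the multinomial coefficient; and (3) δ_i divides n!. -/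

import Mathlib

noncomputable section

namespace OneSidedCycleShuffles

/-- `sw n i` is the simple transposition `s_i ∈ S_n` (1-indexed: it swaps the values `i` and
`i+1` of `[n] = {1,…,n}`, realized on the carrier `Fin n` via the identification
`x ∈ [n] ↔ ⟨x-1⟩ : Fin n`); it is the junk value `1` unless `i ∈ [n-1]`. -/
def sw (n i : ℕ) : Equiv.Perm (Fin n) :=
  if h : 1 ≤ i ∧ i < n then Equiv.swap ⟨i - 1, by omega⟩ ⟨i, h.2⟩ else 1

/-- `cyc n l j` is the cycle `cyc_{l,l+1,…,j} ∈ S_n` (sending `l,…,j-1,j` to `l+1,…,j,l`),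
written as the product `s_l s_{l+1} ⋯ s_{j-1}` of simple transpositions. -/
def cyc (n l j : ℕ) : Equiv.Perm (Fin n) :=
  ((List.range' l (j - l)).map (sw n)).prod

/-- The somewhere-to-below shuffle `t_ℓ = cyc_ℓ + cyc_{ℓ,ℓ+1} + ⋯ + cyc_{ℓ,ℓ+1,…,n} ∈ k[S_n]`. -/
def t (n : ℕ) (k : Type*) [CommRing k] (l : ℕ) : MonoidAlgebra k (Equiv.Perm (Fin n)) :=
  ∑ j ∈ Finset.Icc l n, MonoidAlgebra.of k (Equiv.Perm (Fin n)) (cyc n l j)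

/-- `m_{I,ℓ}` : (the smallest element of the enclosure `{0} ∪ I ∪ {n+1}` that is `≥ ℓ`) `- ℓ`. -/
def mIdx (n : ℕ) (I : Finset ℕ) (l : ℕ) : ℕ :=
  sInf {x : ℕ | (x = 0 ∨ x ∈ I ∨ x = n + 1) ∧ l ≤ x} - l

/-- The non-shadow `I' = [n-1] \ (I ∪ (I-1))`. -/
def nonShadow (n : ℕ) (I : Finset ℕ) : Finset ℕ :=
  Finset.Icc 1 (n - 1) \ (I ∪ I.image (fun i => i - 1))

/-- A set of integers is lacunar if it contains no two consecutive integers. -/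
def Lacunar (I : Finset ℕ) : Prop := ∀ i ∈ I, i + 1 ∉ I

instance : DecidablePred Lacunar := fun I =>
  decidable_of_iff (∀ i ∈ I, i + 1 ∉ I) Iff.rfl

/-- The invariant space `F(I) = {q ∈ k[S_n] : q s_i = q for all i ∈ I'}`. -/
def F (n : ℕ) (k : Type*) [CommRing k] (I : Finset ℕ) :
    Submodule k (MonoidAlgebra k (Equiv.Perm (Fin n))) where
  carrier := {q | ∀ i ∈ nonShadow n I, q * MonoidAlgebra.of k (Equiv.Perm (Fin n)) (sw n i) = q}
  add_mem' := by
    intro a b ha hb i hi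
    rw [add_mul, ha i hi, hb i hi]
  zero_mem' := by
    intro i hi
    rw [zero_mul]
  smul_mem' := by
    intro c a ha i hi
    rw [smul_mul_assoc, ha i hi]

/-- `F(<c) = ∑_{J ⊆ [n], sum J < c} F(J)`. -/
def Flt (n : ℕ) (k : Type*) [CommRing k] (c : ℕ) :
    Submodule k (MonoidAlgebra k (Equiv.Perm (Fin n))) :=
  ∑ J ∈ (Finset.Icc 1 n).powerset.filter (fun J => J.sum id < c), F n k J

/-- `F_i = F(Q_1) + ⋯ + F(Q_i)` for an enumeration `Q` of the lacunar subsets of `[n-1]`. -/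
def Fi (n : ℕ) (k : Type*) [CommRing k] (Q : ℕ → Finset ℕ) (i : ℕ) :
    Submodule k (MonoidAlgebra k (Equiv.Perm (Fin n))) :=
  ∑ j ∈ Finset.Icc 1 i, F n k (Q j)

/-- The (1-indexed) value `w(i) ∈ [n]` of a permutation `w ∈ S_n` at `i ∈ [n]`
(junk value `0` if out of range). -/
def pval (n : ℕ) (w : Equiv.Perm (Fin n)) (i : ℕ) : ℕ :=
  if h : i - 1 < n then (w ⟨i - 1, h⟩).val + 1 else 0

/-- The descent set `Des w = {i ∈ [n-1] : w(i) > w(i+1)}`. -/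
def Des (n : ℕ) (w : Equiv.Perm (Fin n)) : Finset ℕ :=
  (Finset.Icc 1 (n - 1)).filter fun i => pval n w (i + 1) < pval n w i

/-- `G(T)` : the subgroup of `S_n` generated by the simple transpositions `s_i`, `i ∈ T`. -/
def G (n : ℕ) (T : Finset ℕ) : Subgroup (Equiv.Perm (Fin n)) :=
  Subgroup.closure ((T.image (sw n) : Finset (Equiv.Perm (Fin n))) : Set (Equiv.Perm (Fin n)))

open scoped Classical in
/-- `a_w = ∑_{σ ∈ G(Des w)} wσ ∈ k[S_n]`. -/
def aw (n : ℕ) (k : Type*) [CommRing k] (w : Equiv.Perm (Fin n)) :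
    MonoidAlgebra k (Equiv.Perm (Fin n)) :=
  ∑ σ ∈ Finset.univ.filter (fun σ => σ ∈ G n (Des n w)),
    MonoidAlgebra.of k (Equiv.Perm (Fin n)) (w * σ)

/-- The Q-index of `w` : the smallest `i ∈ [f_{n+1}]` with `Q_i' ⊆ Des w`. -/
def Qind (n : ℕ) (Q : ℕ → Finset ℕ) (w : Equiv.Perm (Fin n)) : ℕ :=
  sInf {i : ℕ | 1 ≤ i ∧ i ≤ Nat.fib (n + 1) ∧ nonShadow n (Q i) ⊆ Des n w}

/-- The set of inversions of `u ∈ S_n` : pairs `(i,j) ∈ [n] × [n]` with `i < j`, `u(i) > u(j)`. -/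
def InvSet (n : ℕ) (u : Equiv.Perm (Fin n)) : Finset (ℕ × ℕ) :=
  (Finset.Icc 1 n ×ˢ Finset.Icc 1 n).filter fun p => p.1 < p.2 ∧ pval n u p.2 < pval n u p.1

/-- The lexicographic order on `S_n` : `u < v` iff at the smallest `i ∈ [n]` where they
differ, `u(i) < v(i)`. -/
def lexLT (n : ℕ) (u v : Equiv.Perm (Fin n)) : Prop :=
  ∃ i ∈ Finset.Icc 1 n, pval n u i < pval n v i ∧
    ∀ j ∈ Finset.Icc 1 n, j < i → pval n u j = pval n v j

/-- `Z(I) = {q ∈ k[S_n] : q s_i = q for all i ∈ I}`. -/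
def Z (n : ℕ) (k : Type*) [CommRing k] (I : Finset ℕ) :
    Submodule k (MonoidAlgebra k (Equiv.Perm (Fin n))) where
  carrier := {q | ∀ i ∈ I, q * MonoidAlgebra.of k (Equiv.Perm (Fin n)) (sw n i) = q}
  add_mem' := by
    intro a b ha hb i hi
    rw [add_mul, ha i hi, hb i hi]
  zero_mem' := by
    intro i hi
    rw [zero_mul]
  smul_mem' := by
    intro c a ha i hi
    rw [smul_mul_assoc, ha i hi]

/-- `R(x)` : right multiplication by `x`, as a `k`-module endomorphism of `k[S_n]`. -/
def Rmul (n : ℕ) (k : Type*) [CommRing k] (x : MonoidAlgebra k (Equiv.Perm (Fin n))) :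
    Module.End k (MonoidAlgebra k (Equiv.Perm (Fin n))) :=
  LinearMap.mulRight k x

/-- The lists that enumerate the elements of `S` without repetition. -/
def arrangements {α : Type*} (S : Finset α) : Finset (List α) :=
  ⟨S.val.lists, Multiset.lists_nodup_finset S⟩

/-- The list `l` ascends at every (0-indexed) position in `A` and descends at every position
in `B`, where only positions having a successor in `l` are considered. -/
def Fits {α : Type*} [LinearOrder α] (A B : ℕ → Prop) (l : List α) : Prop :=
  ∀ (a : ℕ) (h : a + 1 < l.length), (A a → l[a] < l[a + 1]) ∧ (B a → l[a + 1] < l[a])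

section Counting

open scoped Classical

theorem mem_arrangements {α : Type*} [DecidableEq α] {S : Finset α} {l : List α} :
    l ∈ arrangements S ↔ l.Nodup ∧ l.toFinset = S := by
  have h : l ∈ arrangements S ↔ S.val = (l : Multiset α) := Multiset.mem_lists_iff _ _
  rw [h]
  constructor
  · intro h
    refine ⟨by simpa [h] using S.nodup, ?_⟩
    ext x
    rw [List.mem_toFinset, ← Finset.mem_val, h, Multiset.mem_coe]
  · rintro ⟨hl, rfl⟩
    rw [List.toFinset_val, hl.dedup]

theorem length_of_mem_arrangements {α : Type*} {S : Finset α} {l : List α}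
    (h : l ∈ arrangements S) : l.length = S.card := by
  obtain ⟨h1, rfl⟩ := mem_arrangements.1 h
  exact (List.toFinset_card_of_nodup h1).symm

theorem append_mem_arrangements {α : Type*} [DecidableEq α] {S T : Finset α}
    {l m : List α} (hT : T ⊆ S) (hl : l ∈ arrangements T) (hm : m ∈ arrangements (S \ T)) : l ++ m ∈ arrangements S := by
  rw [mem_arrangements] at *
  refine ⟨List.nodup_append'.2 ⟨hl.1, hm.1, ?_⟩, ?_⟩
  · rw [← List.disjoint_toFinset_iff_disjoint, hl.2, hm.2]
    exact Finset.disjoint_sdiff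
  · rw [List.toFinset_append, hl.2, hm.2, Finset.union_sdiff_of_subset hT]

/-- An arrangement of `S` amounts to a choice of the set of its first `a` entries together with
arrangements of this set and of its complement. -/
theorem card_filter_take_drop {α : Type*} [DecidableEq α] (S : Finset α) (a : ℕ)
    (ha : a ≤ S.card) (P R : List α → Prop) [DecidablePred P] [DecidablePred R] :
    ((arrangements S).filter fun l => P (l.take a) ∧ R (l.drop a)).card =
      ∑ T ∈ S.powersetCard a,
        ((arrangements T).filter P).card * ((arrangements (S \ T)).filter R).card := by
  simp_rw [← Finset.card_product]
  rw [← Finset.card_sigma]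
  symm
  refine Finset.card_bij' (fun x _ => x.2.1 ++ x.2.2)
    (fun l _ => ⟨(l.take a).toFinset, l.take a, l.drop a⟩) ?_ ?_ ?_ ?_
  · rintro ⟨T, l, m⟩ h
    simp only [Finset.mem_sigma, Finset.mem_powersetCard, Finset.mem_product,
      Finset.mem_filter] at h ⊢
    obtain ⟨⟨hT, rfl⟩, ⟨hl, hP⟩, hm, hR⟩ := h
    have hlen := length_of_mem_arrangements hl
    rw [← hlen, List.take_left, List.drop_left]
    exact ⟨append_mem_arrangements hT hl hm, hP, hR⟩
  · intro l h
    simp only [Finset.mem_sigma, Finset.mem_powersetCard, Finset.mem_product,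
      Finset.mem_filter] at h ⊢
    obtain ⟨hl, hP, hR⟩ := h
    have hlen := length_of_mem_arrangements hl
    obtain ⟨hn, rfl⟩ := mem_arrangements.1 hl
    have hn' := hn
    rw [← List.take_append_drop a l, List.nodup_append', ← List.disjoint_toFinset_iff_disjoint]
      at hn'
    have hU : l.toFinset = (l.take a).toFinset ∪ (l.drop a).toFinset := by
      rw [← List.toFinset_append, List.take_append_drop]
    refine ⟨⟨?_, ?_⟩, ⟨mem_arrangements.2 ⟨hn'.1, rfl⟩, hP⟩,
      mem_arrangements.2 ⟨hn'.2.1, ?_⟩, hR⟩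
    · rw [hU]; exact Finset.subset_union_left
    · rw [List.toFinset_card_of_nodup hn'.1, List.length_take]
      omega
    · rw [hU, Finset.union_sdiff_cancel_left hn'.2.2]
  · rintro ⟨T, l, m⟩ h
    simp only [Finset.mem_sigma, Finset.mem_powersetCard, Finset.mem_product,
      Finset.mem_filter] at h ⊢
    obtain ⟨⟨hT, rfl⟩, ⟨hl, hP⟩, hm, hR⟩ := h
    have hlen := length_of_mem_arrangements hl
    obtain ⟨hn, h2⟩ := mem_arrangements.1 hl
    rw [← hlen, List.take_left, List.drop_left, h2]
  · intro l h
    exact List.take_append_drop a l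

variable {α : Type*} [LinearOrder α]

theorem Fits.congr {A B A' B' : ℕ → Prop} {l : List α}
    (h : ∀ a, a + 1 < l.length → (A a ↔ A' a) ∧ (B a ↔ B' a)) : Fits A B l ↔ Fits A' B' l := by
  refine forall_congr' fun a => forall_congr' fun ha => ?_
  rw [(h a ha).1, (h a ha).2]

theorem fits_iff_take_drop {A B : ℕ → Prop} {l : List α} {a : ℕ}
    (hA : ∀ b, b + 1 = a → ¬ A b ∧ ¬ B b) :
    Fits A B l ↔ Fits A B (l.take a) ∧
      Fits (fun b => A (a + b)) (fun b => B (a + b)) (l.drop a) := by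
  constructor
  · intro h
    refine ⟨fun b hb => ?_, fun b hb => ?_⟩
    · rw [List.length_take] at hb
      simpa using h b (by omega)
    · rw [List.length_drop] at hb
      simpa [add_assoc] using h (a + b) (by omega)
  · rintro ⟨h1, h2⟩ b hb
    rcases lt_trichotomy (b + 1) a with h | h | h
    · have := h1 b (by rw [List.length_take]; omega)
      rwa [List.getElem_take, List.getElem_take] at this
    · exact ⟨fun h' => absurd h' (hA b h).1, fun h' => absurd h' (hA b h).2⟩
    · obtain ⟨c, rfl⟩ := Nat.exists_eq_add_of_le (Nat.lt_succ_iff.1 h)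
      have := h2 c (by rw [List.length_drop]; omega)
      rwa [List.getElem_drop, List.getElem_drop] at this

theorem fits_desc_iff {A : ℕ → Prop} (hA : ∀ a, ¬ A a) {l : List α} :
    Fits A (fun _ => True) l ↔ l.SortedGT := by
  rw [List.sortedGT_iff_isChain, List.isChain_iff_getElem]
  simp [Fits, hA]

theorem eq_sort_of_sortedGT {S : Finset α} {l : List α} (hl : l ∈ arrangements S)
    (h : l.SortedGT) : l = S.sort (· ≥ ·) := by
  obtain ⟨hn, hS⟩ := mem_arrangements.1 hl
  refine List.Perm.eq_of_pairwise (le := (· ≥ ·)) ?_ ?_ ?_ ?_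
  · intro a b _ _ h1 h2
    exact le_antisymm h2 h1
  · exact h.pairwise.imp le_of_lt
  · exact S.pairwise_sort _
  · rw [List.perm_ext_iff_of_nodup hn (S.sort_nodup _)]
    intro a
    rw [Finset.mem_sort, ← hS, List.mem_toFinset]

theorem sort_mem_arrangements (S : Finset α) : S.sort (· ≥ ·) ∈ arrangements S :=
  mem_arrangements.2 ⟨S.sort_nodup _, S.sort_toFinset _⟩

theorem card_sortedGT_arrangements (S : Finset α) :
    ((arrangements S).filter fun l => l.SortedGT).card = 1 := by
  refine Finset.card_eq_one.2 ⟨S.sort (· ≥ ·), ?_⟩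
  ext l
  rw [Finset.mem_filter, Finset.mem_singleton]
  constructor
  · exact fun h => eq_sort_of_sortedGT h.1 h.2
  · rintro rfl
    exact ⟨sort_mem_arrangements S, S.sortedGT_sort⟩

/-- There are `|S| - 1` arrangements of `S` that ascend in the first step and descend in all the
others. -/
theorem card_ascent_then_descents (S : Finset α) (hS : 2 ≤ S.card) :
    ((arrangements S).filter fun l => Fits (fun a => a = 0) (fun a => a ≠ 0) l).card =
      S.card - 1 := by
  have hall : ((arrangements S).filter fun l => (l.drop 1).SortedGT).card = S.card := by
    have h := card_filter_take_drop S 1 (by omega) (fun _ => True) (fun l => l.SortedGT)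
    simp only [true_and] at h
    rw [h, Finset.sum_congr rfl (g := fun _ => 1)]
    · simp
    · intro T hT
      obtain ⟨x, rfl⟩ := Finset.card_eq_one.1 (Finset.mem_powersetCard.1 hT).2
      rw [card_sortedGT_arrangements, mul_one, Finset.card_eq_one]
      refine ⟨[x], ?_⟩
      ext l
      simp only [Finset.filter_true, Finset.mem_singleton]
      constructor
      · intro hl
        have h1 := length_of_mem_arrangements hl
        obtain ⟨y, rfl⟩ := List.length_eq_one_iff.1 (h1.trans (Finset.card_singleton x))
        have := (mem_arrangements.1 hl).2
        simp at this
        rw [this]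
      · rintro rfl
        exact mem_arrangements.2 ⟨by simp, by simp⟩
  have hsplit := Finset.card_filter_add_card_filter_not
    (s := (arrangements S).filter fun l => (l.drop 1).SortedGT) (fun l => l.SortedGT)
  rw [hall, Finset.filter_filter, Finset.filter_filter] at hsplit
  have h1 : ((arrangements S).filter fun l => (l.drop 1).SortedGT ∧ l.SortedGT).card = 1 := by
    refine Eq.trans (congrArg Finset.card ?_) (card_sortedGT_arrangements S)
    refine Finset.filter_congr fun l _ => ⟨fun h => h.2, fun h => ⟨?_, h⟩⟩
    exact (h.pairwise.sublist (List.drop_sublist 1 l)).sortedGT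
  have h2 : ((arrangements S).filter fun l => (l.drop 1).SortedGT ∧ ¬ l.SortedGT) =
      (arrangements S).filter fun l => Fits (fun a => a = 0) (fun a => a ≠ 0) l := by
    refine Finset.filter_congr fun l hl => ?_
    have hlen := length_of_mem_arrangements hl
    have hn := (mem_arrangements.1 hl).1
    match l, hlen with
    | [], h => simp at h; omega
    | [x], h => simp at h; omega
    | x :: y :: l, _ =>
      have hxy : x ≠ y := by
        rintro rfl
        simp at hn
      have hf : Fits (fun a => a = 0) (fun a => a ≠ 0) (x :: y :: l) ↔
          x < y ∧ (y :: l).SortedGT := by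
        rw [List.sortedGT_iff_isChain, List.isChain_iff_getElem]
        constructor
        · intro h
          refine ⟨by simpa using (h 0 (by simp)).1, fun a ha => ?_⟩
          exact (h (a + 1) (by simpa using ha)).2 a.succ_ne_zero
        · rintro ⟨h, h'⟩ a ha
          rcases a with _ | a
          · simpa using h
          · exact ⟨fun h0 => absurd h0 a.succ_ne_zero, fun _ => h' a (by simpa using ha)⟩
      rw [hf, List.drop_one, List.tail_cons, List.sortedGT_iff_isChain,
        List.sortedGT_iff_isChain, List.isChain_cons_cons]
      constructor
      · rintro ⟨h, h'⟩
        exact ⟨lt_of_le_of_ne (not_lt.1 fun h'' => h' ⟨h'', h⟩) hxy, h⟩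
      · rintro ⟨h, h'⟩
        exact ⟨h', fun h'' => lt_asymm h h''.1⟩
  rw [h1, h2] at hsplit
  omega

/-- The number of arrangements of `S` that ascend at the positions `e 1, …, e p` and descend
at all positions that are not of the form `e m` or `e m - 1`. -/
theorem card_fits_mul_prod_factorial (e : ℕ → ℕ) (he0 : e 0 = 1) (he1 : 1 ≤ e 1) (p : ℕ)
    (hgap : ∀ m, 1 ≤ m → m ≤ p → e m + 2 ≤ e (m + 1))
    (S : Finset α) (hS : S.card + 1 = e (p + 1)) :
    ((arrangements S).filter fun l => Fits (fun a => ∃ m, 1 ≤ m ∧ m ≤ p ∧ e m = a + 1)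
        (fun a => ∀ m, 1 ≤ m → m ≤ p → e m ≠ a + 1 ∧ e m ≠ a + 2) l).card *
      ∏ m ∈ Finset.Icc 1 (p + 1), (e m - e (m - 1)).factorial =
    S.card.factorial * ∏ m ∈ Finset.Icc 2 (p + 1), (e m - e (m - 1) - 1) := by
  induction p generalizing S with
  | zero =>
    have h : e 1 - 1 = S.card := by rw [zero_add] at hS; omega
    have hc := card_sortedGT_arrangements S
    simp only [← fits_desc_iff (A := fun _ => False) (by simp)] at hc
    rw [Finset.filter_congr (q := fun l => Fits (fun _ => False) (fun _ => True) l), hc]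
    · simp [he0, h]
    intro l hl
    refine Fits.congr fun a ha => ⟨iff_of_false ?_ id, iff_of_true ?_ trivial⟩
    · rintro ⟨m, h1, h2, -⟩; omega
    · intro m h1 h2; omega
  | succ p ih =>
    have hmono : ∀ m, 1 ≤ m → m ≤ p → e m + 2 ≤ e (p + 1) := by
      intro m h1 h2
      clear ih hS
      induction p, h2 using Nat.le_induction with
      | base => exact hgap m h1 (by omega)
      | succ q hq ihq =>
        have := ihq fun k hk hk' => hgap k hk (by omega)
        have := hgap (q + 1) (by omega) (by omega)
        omega
    have hlast := hgap (p + 1) (by omega) le_rfl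
    have hpos : 1 ≤ e (p + 1) := by
      rcases p.eq_zero_or_pos with rfl | hp
      · exact he1
      · have := hmono p hp le_rfl; omega
    obtain ⟨c, hc⟩ : ∃ c, e (p + 1) = c + 1 := ⟨e (p + 1) - 1, by omega⟩
    have hcS : c ≤ S.card := by omega
    have hiff : ∀ l ∈ arrangements S,
        (Fits (fun a => ∃ m, 1 ≤ m ∧ m ≤ p + 1 ∧ e m = a + 1)
          (fun a => ∀ m, 1 ≤ m → m ≤ p + 1 → e m ≠ a + 1 ∧ e m ≠ a + 2) l ↔
        Fits (fun a => ∃ m, 1 ≤ m ∧ m ≤ p ∧ e m = a + 1)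
          (fun a => ∀ m, 1 ≤ m → m ≤ p → e m ≠ a + 1 ∧ e m ≠ a + 2) (l.take c) ∧
        Fits (fun a => a = 0) (fun a => a ≠ 0) (l.drop c)) := by
      intro l hl
      rw [fits_iff_take_drop (a := c)]
      · refine and_congr (Fits.congr fun a ha => ?_) (Fits.congr fun a ha => ?_)
        · rw [List.length_take] at ha
          refine ⟨⟨?_, ?_⟩, ?_, ?_⟩
          · rintro ⟨m, h1, h2, h3⟩
            rcases h2.eq_or_lt with rfl | h2
            · omega
            · exact ⟨m, h1, by omega, h3⟩
          · rintro ⟨m, h1, h2, h3⟩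
            exact ⟨m, h1, by omega, h3⟩
          · exact fun h m h1 h2 => h m h1 (by omega)
          · intro h m h1 h2
            rcases h2.eq_or_lt with rfl | h2
            · omega
            · exact h m h1 (by omega)
        · refine ⟨⟨?_, ?_⟩, ?_, ?_⟩
          · rintro ⟨m, h1, h2, h3⟩
            rcases h2.eq_or_lt with rfl | h2
            · omega
            · have := hmono m h1 (by omega); omega
          · rintro rfl
            exact ⟨p + 1, by omega, le_rfl, hc⟩
          · rintro h rfl
            exact (h (p + 1) (by omega) le_rfl).1 hc
          · intro h m h1 h2
            rcases h2.eq_or_lt with rfl | h2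
            · omega
            · have := hmono m h1 (by omega); omega
      · intro b hb
        constructor
        · rintro ⟨m, h1, h2, h3⟩
          rcases h2.eq_or_lt with rfl | h2
          · omega
          · have := hmono m h1 (by omega); omega
        · intro h
          have := (h (p + 1) (by omega) le_rfl).2
          omega
    rw [Finset.filter_congr hiff, card_filter_take_drop S c hcS]
    rw [Finset.prod_Icc_succ_top (by omega : 1 ≤ p + 1 + 1),
      Finset.prod_Icc_succ_top (by omega : 2 ≤ p + 1 + 1)]
    have hj : e (p + 1 + 1) - e (p + 1 + 1 - 1) = S.card - c := by
      simp only [Nat.add_sub_cancel]; omega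
    rw [hj]
    have hterm : ∀ T ∈ S.powersetCard c,
        (((arrangements T).filter fun l => Fits (fun a => ∃ m, 1 ≤ m ∧ m ≤ p ∧ e m = a + 1)
          (fun a => ∀ m, 1 ≤ m → m ≤ p → e m ≠ a + 1 ∧ e m ≠ a + 2) l).card *
        ((arrangements (S \ T)).filter fun l => Fits (fun a => a = 0) (fun a => a ≠ 0) l).card) *
        ((∏ m ∈ Finset.Icc 1 (p + 1), (e m - e (m - 1)).factorial) * (S.card - c).factorial) =
        c.factorial * (S.card - c).factorial *
          ((∏ m ∈ Finset.Icc 2 (p + 1), (e m - e (m - 1) - 1)) * (S.card - c - 1)) := by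
      intro T hT
      obtain ⟨hTS, hTc⟩ := Finset.mem_powersetCard.1 hT
      have h1 := ih (fun m h h' => hgap m h (by omega)) T (by omega)
      have hcard : (S \ T).card = S.card - c := by rw [Finset.card_sdiff_of_subset hTS, hTc]
      rw [card_ascent_then_descents (S \ T) (by omega), hcard, mul_mul_mul_comm, h1, hTc]
      ring
    rw [Finset.sum_mul]
    refine (Finset.sum_congr rfl hterm).trans ?_
    rw [Finset.sum_const, Finset.card_powersetCard,
      smul_eq_mul, ← mul_assoc, ← mul_assoc (S.card.choose c),
      Nat.choose_mul_factorial_mul_factorial hcS]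

end Counting

section QIndex

theorem mem_nonShadow {n : ℕ} {I : Finset ℕ} {a : ℕ} (ha : 1 ≤ a) :
    a ∈ nonShadow n I ↔ a ≤ n - 1 ∧ a ∉ I ∧ a + 1 ∉ I := by
  simp only [nonShadow, Finset.mem_sdiff, Finset.mem_Icc, Finset.mem_union, Finset.mem_image,
    not_or, not_exists, not_and]
  constructor
  · rintro ⟨h1, h2, h3⟩
    exact ⟨h1.2, h2, fun h => h3 _ h rfl⟩
  · rintro ⟨h1, h2, h3⟩
    refine ⟨⟨ha, h1⟩, h2, fun b hb hba => h3 ?_⟩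
    rwa [← hba, Nat.sub_add_cancel (by omega)]

theorem one_le_of_mem_nonShadow {n : ℕ} {I : Finset ℕ} {a : ℕ} (ha : a ∈ nonShadow n I) :
    1 ≤ a :=
  (Finset.mem_Icc.1 (Finset.mem_sdiff.1 ha).1).1

/-- Every subset of `[n-1]` whose non-shadow lies in `D` can be replaced by a lacunar one that is
disjoint from `D`, without increasing the sum. -/
theorem exists_lacunar_disjoint (n : ℕ) (D : Finset ℕ) (J : Finset ℕ)
    (hJ : J ⊆ Finset.Icc 1 (n - 1)) (hD : nonShadow n J ⊆ D) :
    ∃ K ⊆ Finset.Icc 1 (n - 1), Lacunar K ∧ nonShadow n K ⊆ D ∧ Disjoint K D ∧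
      (K = J ∨ K.sum id < J.sum id) := by
  induction hs : J.sum id using Nat.strong_induction_on generalizing J with
  | _ s ih =>
    subst hs
    by_cases h : ∃ j ∈ J, j ∈ D ∨ j + 1 ∈ J
    · obtain ⟨j, hjJ, hj⟩ := h
      have hj1 : 1 ≤ j ∧ j ≤ n - 1 := Finset.mem_Icc.1 (hJ hjJ)
      set J₁ := (insert (j - 1) (J.erase j)).erase 0 with hJ₁
      have hmem : ∀ x, x ∈ J₁ ↔ x ≠ 0 ∧ (x = j - 1 ∨ (x ≠ j ∧ x ∈ J)) := by
        intro x; simp [hJ₁]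
      have hlt : J₁.sum id < J.sum id := by
        have h1 : J₁.sum id ≤ (insert (j - 1) (J.erase j)).sum id :=
          Finset.sum_le_sum_of_subset (Finset.erase_subset _ _)
        have h2 := Finset.add_sum_erase J id hjJ
        have h3 : (insert (j - 1) (J.erase j)).sum id ≤ (j - 1) + (J.erase j).sum id := by
          by_cases h : j - 1 ∈ J.erase j
          · rw [Finset.insert_eq_of_mem h]; omega
          · rw [Finset.sum_insert h]; rfl
        simp only [id] at *
        omega
      obtain ⟨K, hK1, hK2, hK3, hK4, hK5⟩ := ih _ hlt J₁ (fun x hx => by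
          rcases (hmem x).1 hx with ⟨h0, rfl | h⟩
          · rw [Finset.mem_Icc]; omega
          · exact hJ h.2) (fun x hx => by
          have hx1 := one_le_of_mem_nonShadow hx
          rw [mem_nonShadow hx1, hmem, hmem] at hx
          by_cases hxj : x = j
          · subst hxj
            refine hj.resolve_right fun h => hx.2.2 ⟨by omega, Or.inr ⟨by omega, h⟩⟩
          · refine hD ((mem_nonShadow hx1).2 ⟨hx.1, fun h => hx.2.1 ⟨by omega, .inr ⟨hxj, h⟩⟩,
              fun h => hx.2.2 ⟨by omega, .inr ⟨fun h' => ?_, h⟩⟩⟩)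
            exact hx.2.1 ⟨by omega, .inl (by omega)⟩) rfl
      refine ⟨K, hK1, hK2, hK3, hK4, .inr ?_⟩
      rcases hK5 with rfl | h
      · exact hlt
      · exact h.trans hlt
    · push Not at h
      exact ⟨J, hJ, fun j hj => (h j hj).2, hD,
        Finset.disjoint_left.2 fun j hj => (h j hj).1, .inl rfl⟩

/-- A lacunar subset `K` of `[n-1]` is determined by any set that contains its non-shadow and is
disjoint from `K`. -/
theorem lacunar_unique {n : ℕ} {D I K : Finset ℕ}
    (hI : I ⊆ Finset.Icc 1 (n - 1)) (hI1 : Lacunar I) (hI2 : nonShadow n I ⊆ D)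
    (hI3 : Disjoint I D)
    (hK : K ⊆ Finset.Icc 1 (n - 1)) (hK1 : Lacunar K) (hK2 : nonShadow n K ⊆ D)
    (hK3 : Disjoint K D) : I = K := by
  have step : ∀ {I K : Finset ℕ} {j : ℕ}, I ⊆ Finset.Icc 1 (n - 1) → Lacunar I → Disjoint I D →
      nonShadow n K ⊆ D → (j + 1 ∈ I ↔ j + 1 ∈ K) → j ∈ I → j ∈ K := by
    intro I K j hI hI1 hI3 hK2 hiff hj
    by_contra hjK
    have hj1 := Finset.mem_Icc.1 (hI hj)
    refine Finset.disjoint_left.1 hI3 hj (hK2 ((mem_nonShadow hj1.1).2 ⟨hj1.2, hjK, ?_⟩))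
    rw [← hiff]
    exact hI1 j hj
  have key : ∀ d j, n ≤ j + d → (j ∈ I ↔ j ∈ K) := by
    intro d
    induction d with
    | zero =>
      intro j hj
      refine iff_of_false (fun h => ?_) fun h => ?_
      · have := Finset.mem_Icc.1 (hI h); omega
      · have := Finset.mem_Icc.1 (hK h); omega
    | succ d ih =>
      intro j hj
      have := ih (j + 1) (by omega)
      exact ⟨step hI hI1 hI3 hK2 this, step hK hK1 hK3 hI2 this.symm⟩
  ext j
  exact key n j (by omega)

theorem Qind_eq_iff (n : ℕ) (Q : ℕ → Finset ℕ)
    (hQlac : ∀ i ∈ Finset.Icc 1 (Nat.fib (n + 1)),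
      Q i ⊆ Finset.Icc 1 (n - 1) ∧ Lacunar (Q i))
    (hQbij : ∀ J : Finset ℕ, J ⊆ Finset.Icc 1 (n - 1) → Lacunar J →
      ∃! i, i ∈ Finset.Icc 1 (Nat.fib (n + 1)) ∧ Q i = J)
    (hQmono : ∀ i ∈ Finset.Icc 1 (Nat.fib (n + 1)), ∀ j ∈ Finset.Icc 1 (Nat.fib (n + 1)),
      i ≤ j → (Q i).sum id ≤ (Q j).sum id)
    (i : ℕ) (hi : i ∈ Finset.Icc 1 (Nat.fib (n + 1))) (w : Equiv.Perm (Fin n)) :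
    Qind n Q w = i ↔ Disjoint (Q i) (Des n w) ∧ nonShadow n (Q i) ⊆ Des n w := by
  set s := {i : ℕ | 1 ≤ i ∧ i ≤ Nat.fib (n + 1) ∧ nonShadow n (Q i) ⊆ Des n w} with hs
  have hdisj : s.Nonempty → Qind n Q w ∈ s ∧ Disjoint (Q (Qind n Q w)) (Des n w) := by
    intro hne
    have hm : Qind n Q w ∈ s := Nat.sInf_mem hne
    refine ⟨hm, ?_⟩
    have hm' : Qind n Q w ∈ Finset.Icc 1 (Nat.fib (n + 1)) := Finset.mem_Icc.2 ⟨hm.1, hm.2.1⟩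
    obtain ⟨K, hK1, hK2, hK3, hK4, hK5⟩ :=
      exists_lacunar_disjoint n (Des n w) _ (hQlac _ hm').1 hm.2.2
    rcases hK5 with h | h
    · rwa [← h]
    · obtain ⟨k, ⟨hk, rfl⟩, -⟩ := hQbij K hK1 hK2
      have hle : Qind n Q w ≤ k :=
        Nat.sInf_le ⟨(Finset.mem_Icc.1 hk).1, (Finset.mem_Icc.1 hk).2, hK3⟩
      exact absurd (hQmono _ hm' _ hk hle) (not_le.2 h)
  constructor
  · rintro rfl
    have hne : s.Nonempty := by
      refine Nat.nonempty_of_pos_sInf (s := s) ?_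
      exact (Finset.mem_Icc.1 hi).1
    exact ⟨(hdisj hne).2, (hdisj hne).1.2.2⟩
  · rintro ⟨h1, h2⟩
    have hi' := Finset.mem_Icc.1 hi
    obtain ⟨hm, hd⟩ := hdisj ⟨i, hi'.1, hi'.2, h2⟩
    have hm' : Qind n Q w ∈ Finset.Icc 1 (Nat.fib (n + 1)) := Finset.mem_Icc.2 ⟨hm.1, hm.2.1⟩
    have heq : Q (Qind n Q w) = Q i :=
      lacunar_unique (hQlac _ hm').1 (hQlac _ hm').2 hm.2.2 hd (hQlac i hi).1 (hQlac i hi).2 h2 h1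
    exact (hQbij (Q i) (hQlac i hi).1 (hQlac i hi).2).unique ⟨hm', heq⟩ ⟨hi, rfl⟩

theorem pval_succ {n : ℕ} (w : Equiv.Perm (Fin n)) {a : ℕ} (ha : a < n) :
    pval n w (a + 1) = (w ⟨a, ha⟩ : ℕ) + 1 := by
  simp [pval, ha]

theorem mem_Des_iff {n : ℕ} {w : Equiv.Perm (Fin n)} {a : ℕ} (ha : a ∈ Finset.Icc 1 (n - 1)) :
    a ∈ Des n w ↔ pval n w (a + 1) < pval n w a := by
  simp [Des, -Finset.mem_Icc, ha]

theorem not_mem_Des_iff {n : ℕ} {w : Equiv.Perm (Fin n)} {a : ℕ}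
    (ha : a ∈ Finset.Icc 1 (n - 1)) : a ∉ Des n w ↔ pval n w a < pval n w (a + 1) := by
  rw [mem_Des_iff ha, not_lt, le_iff_lt_or_eq, or_iff_left]
  obtain ⟨b, rfl⟩ : ∃ b, a = b + 1 := ⟨a - 1, by rw [Finset.mem_Icc] at ha; omega⟩
  rw [Finset.mem_Icc] at ha
  rw [pval_succ w (a := b) (by omega), pval_succ w (a := b + 1) (by omega)]
  intro h
  have := w.injective (Fin.ext (Nat.succ_injective h))
  simp at this

theorem Qind_eq_iff_pval (n : ℕ) (Q : ℕ → Finset ℕ)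
    (hQlac : ∀ i ∈ Finset.Icc 1 (Nat.fib (n + 1)),
      Q i ⊆ Finset.Icc 1 (n - 1) ∧ Lacunar (Q i))
    (hQbij : ∀ J : Finset ℕ, J ⊆ Finset.Icc 1 (n - 1) → Lacunar J →
      ∃! i, i ∈ Finset.Icc 1 (Nat.fib (n + 1)) ∧ Q i = J)
    (hQmono : ∀ i ∈ Finset.Icc 1 (Nat.fib (n + 1)), ∀ j ∈ Finset.Icc 1 (Nat.fib (n + 1)),
      i ≤ j → (Q i).sum id ≤ (Q j).sum id)
    (i : ℕ) (hi : i ∈ Finset.Icc 1 (Nat.fib (n + 1))) (w : Equiv.Perm (Fin n)) :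
    Qind n Q w = i ↔ (∀ a ∈ Q i, pval n w a < pval n w (a + 1)) ∧
      ∀ a ∈ nonShadow n (Q i), pval n w (a + 1) < pval n w a := by
  rw [Qind_eq_iff n Q hQlac hQbij hQmono i hi, Finset.disjoint_left]
  refine and_congr (forall₂_congr fun a ha => ?_) (forall₂_congr fun a ha => ?_)
  · exact not_mem_Des_iff ((hQlac i hi).1 ha)
  · exact mem_Des_iff (Finset.mem_sdiff.1 ha).1

end QIndex

open scoped Classical in
/-- Permutations with a prescribed local pattern correspond to arrangements of `Fin n`. -/
theorem card_perm_eq_card_arrangements (n : ℕ) (A B : Finset ℕ) (hA : A ⊆ Finset.Icc 1 (n - 1))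
    (hB : B ⊆ Finset.Icc 1 (n - 1)) :
    (Finset.univ.filter fun w : Equiv.Perm (Fin n) =>
      (∀ a ∈ A, pval n w a < pval n w (a + 1)) ∧ ∀ a ∈ B, pval n w (a + 1) < pval n w a).card =
    ((arrangements (Finset.univ : Finset (Fin n))).filter fun l =>
      Fits (fun a => a + 1 ∈ A) (fun a => a + 1 ∈ B) l).card := by
  have hfits : ∀ w : Equiv.Perm (Fin n),
      Fits (fun a => a + 1 ∈ A) (fun a => a + 1 ∈ B) (List.ofFn w) ↔
      (∀ a ∈ A, pval n w a < pval n w (a + 1)) ∧ ∀ a ∈ B, pval n w (a + 1) < pval n w a := by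
    intro w
    constructor
    · intro h
      constructor <;> intro a ha
      · have ha' := Finset.mem_Icc.1 (hA ha)
        obtain ⟨b, rfl⟩ : ∃ b, a = b + 1 := ⟨a - 1, by omega⟩
        rw [pval_succ w (a := b) (by omega), pval_succ w (a := b + 1) (by omega)]
        have := (h b (by rw [List.length_ofFn]; omega)).1 ha
        rw [List.getElem_ofFn, List.getElem_ofFn] at this
        simpa using this
      · have ha' := Finset.mem_Icc.1 (hB ha)
        obtain ⟨b, rfl⟩ : ∃ b, a = b + 1 := ⟨a - 1, by omega⟩
        rw [pval_succ w (a := b) (by omega), pval_succ w (a := b + 1) (by omega)]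
        have := (h b (by rw [List.length_ofFn]; omega)).2 ha
        rw [List.getElem_ofFn, List.getElem_ofFn] at this
        simpa using this
    · rintro ⟨h1, h2⟩ b hb
      rw [List.length_ofFn] at hb
      constructor <;> intro ha
      · have := h1 _ ha
        rw [pval_succ w (a := b) (by omega), pval_succ w (a := b + 1) (by omega)] at this
        simpa using this
      · have := h2 _ ha
        rw [pval_succ w (a := b) (by omega), pval_succ w (a := b + 1) (by omega)] at this
        simpa using this
  refine Finset.card_bij (fun w _ => List.ofFn w) ?_ ?_ ?_
  · intro w hw
    rw [Finset.mem_filter] at hw ⊢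
    refine ⟨mem_arrangements.2 ⟨List.nodup_ofFn.2 w.injective, ?_⟩, (hfits w).2 hw.2⟩
    ext x
    simpa using ⟨w.symm x, by simp⟩
  · intro w _ v _ h
    exact DFunLike.coe_injective (List.ofFn_injective h)
  · intro l hl
    rw [Finset.mem_filter] at hl
    have hlen : l.length = n := by
      simpa using length_of_mem_arrangements hl.1
    have hn := (mem_arrangements.1 hl.1).1
    have hinj : Function.Injective fun a : Fin n => l.get (a.cast hlen.symm) :=
      (List.nodup_iff_injective_get.1 hn).comp (Fin.cast_injective _)
    have hof : List.ofFn (Equiv.ofBijective _ (Finite.injective_iff_bijective.1 hinj)) = l :=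
      List.ext_getElem (by simp [hlen]) fun a _ _ => by
        rw [List.getElem_ofFn]
        simp
    refine ⟨Equiv.ofBijective _ (Finite.injective_iff_bijective.1 hinj), ?_, hof⟩
    rw [Finset.mem_filter, ← hfits, hof]
    exact ⟨Finset.mem_univ _, hl.2⟩

/-- Theorem `thm.deltai.main` (b),(c),(d). Let `i ∈ [f_{n+1}]`, write
`Q_i = {i_1 < i_2 < ⋯ < i_p}` (encoded by a function `e` with `e 0 = 1`,
`e (p+1) = n+1`, `e` strictly increasing on `[1,p]` and `Q_i = {e 1, …, e p}`), and let
`j_k := e k − e (k−1)`. Then `δ_i := #{w ∈ S_n : Qind w = i}` satisfies: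
(1) `δ_i` is the number of `w ∈ S_n` with `w(j) < w(j+1)` for all `j ∈ Q_i` and
`w(j) > w(j+1)` for all `j ∈ Q_i'`;
(2) `δ_i = (n choose j_1, …, j_{p+1}) ⋅ ∏_{k=2}^{p+1} (j_k − 1)`;
(3) `δ_i ∣ n!`. -/
theorem delta_formula (n : ℕ)
    (Q : ℕ → Finset ℕ)
    (hQlac : ∀ i ∈ Finset.Icc 1 (Nat.fib (n + 1)),
      Q i ⊆ Finset.Icc 1 (n - 1) ∧ Lacunar (Q i))
    (hQbij : ∀ J : Finset ℕ, J ⊆ Finset.Icc 1 (n - 1) → Lacunar J →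
      ∃! i, i ∈ Finset.Icc 1 (Nat.fib (n + 1)) ∧ Q i = J)
    (hQmono : ∀ i ∈ Finset.Icc 1 (Nat.fib (n + 1)), ∀ j ∈ Finset.Icc 1 (Nat.fib (n + 1)),
      i ≤ j → (Q i).sum id ≤ (Q j).sum id)
    (i : ℕ) (hi : i ∈ Finset.Icc 1 (Nat.fib (n + 1)))
    (p : ℕ) (e : ℕ → ℕ) (he0 : e 0 = 1) (hep : e (p + 1) = n + 1)
    (hemono : ∀ a b : ℕ, 1 ≤ a → a < b → b ≤ p → e a < e b)
    (heimg : Q i = (Finset.Icc 1 p).image e) :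
    ((Finset.univ.filter (fun w : Equiv.Perm (Fin n) => Qind n Q w = i)).card =
      (Finset.univ.filter (fun w : Equiv.Perm (Fin n) =>
        (∀ a ∈ Q i, pval n w a < pval n w (a + 1)) ∧
        (∀ a ∈ nonShadow n (Q i), pval n w (a + 1) < pval n w a))).card) ∧
    ((Finset.univ.filter (fun w : Equiv.Perm (Fin n) => Qind n Q w = i)).card =
      Nat.multinomial (Finset.Icc 1 (p + 1)) (fun m => e m - e (m - 1)) *
        ∏ m ∈ Finset.Icc 2 (p + 1), (e m - e (m - 1) - 1)) ∧
    (Finset.univ.filter (fun w : Equiv.Perm (Fin n) => Qind n Q w = i)).card ∣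
      Nat.factorial n := by
  have hpt := Qind_eq_iff_pval n Q hQlac hQbij hQmono i hi
  have hcard : (Finset.univ.filter (fun w : Equiv.Perm (Fin n) => Qind n Q w = i)).card =
      (Finset.univ.filter (fun w : Equiv.Perm (Fin n) =>
        (∀ a ∈ Q i, pval n w a < pval n w (a + 1)) ∧
        (∀ a ∈ nonShadow n (Q i), pval n w (a + 1) < pval n w a))).card :=
    congrArg Finset.card (Finset.filter_congr fun w _ => hpt w)
  obtain ⟨hsub, hlac⟩ := hQlac i hi
  have hmem : ∀ a, a ∈ Q i ↔ ∃ m, 1 ≤ m ∧ m ≤ p ∧ e m = a := by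
    intro a
    rw [heimg]
    simp [and_assoc]
  have hrange : ∀ m, 1 ≤ m → m ≤ p → 1 ≤ e m ∧ e m ≤ n - 1 := fun m h1 h2 =>
    Finset.mem_Icc.1 (hsub ((hmem _).2 ⟨m, h1, h2, rfl⟩))
  have he1 : 1 ≤ e 1 := by
    rcases p.eq_zero_or_pos with rfl | hp
    · rw [zero_add] at hep; omega
    · exact (hrange 1 le_rfl hp).1
  have hgap : ∀ m, 1 ≤ m → m ≤ p → e m + 2 ≤ e (m + 1) := by
    intro m h1 h2
    rcases h2.eq_or_lt with rfl | h2'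
    · have := hrange m h1 le_rfl; omega
    · have h3 := hemono m (m + 1) h1 (by omega) h2'
      have h4 : e m + 1 ≠ e (m + 1) := fun h =>
        hlac (e m) ((hmem _).2 ⟨m, h1, h2, rfl⟩) ((hmem _).2 ⟨m + 1, by omega, h2', h.symm⟩)
      omega
  have hle : ∀ m, m ≤ p → e m ≤ e (m + 1) := by
    intro m hm
    rcases m.eq_zero_or_pos with rfl | h
    · rw [he0]; exact he1
    · have := hgap m h hm; omega
  have hcount := card_fits_mul_prod_factorial e he0 he1 p hgap (Finset.univ : Finset (Fin n))
    (by simp [hep])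
  rw [Finset.card_univ, Fintype.card_fin] at hcount
  rw [← hcard]
  classical
  have hδ : (Finset.univ.filter (fun w : Equiv.Perm (Fin n) => Qind n Q w = i)).card *
      ∏ m ∈ Finset.Icc 1 (p + 1), (e m - e (m - 1)).factorial =
      n.factorial * ∏ m ∈ Finset.Icc 2 (p + 1), (e m - e (m - 1) - 1) := by
    rw [← hcount, hcard, card_perm_eq_card_arrangements n (Q i) (nonShadow n (Q i)) hsub
      Finset.sdiff_subset]
    congr 2
    refine Finset.filter_congr fun l hl => Fits.congr fun a ha => ⟨hmem _, ?_⟩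
    have hlen := length_of_mem_arrangements hl
    rw [Finset.card_univ, Fintype.card_fin] at hlen
    rw [mem_nonShadow (by omega), hmem, hmem]
    constructor
    · exact fun h m h1 h2 => ⟨fun h3 => h.2.1 ⟨m, h1, h2, h3⟩, fun h3 => h.2.2 ⟨m, h1, h2, h3⟩⟩
    · intro h
      refine ⟨by omega, ?_, ?_⟩
      · rintro ⟨m, h1, h2, h3⟩
        exact (h m h1 h2).1 h3
      · rintro ⟨m, h1, h2, h3⟩
        exact (h m h1 h2).2 h3
  have hsum : ∑ m ∈ Finset.Icc 1 (p + 1), (e m - e (m - 1)) = n := by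
    have htel : ∀ q, q ≤ p → ∑ m ∈ Finset.Icc 1 (q + 1), (e m - e (m - 1)) + 1 = e (q + 1) := by
      intro q
      induction q with
      | zero =>
        intro _
        simp [he0]
        omega
      | succ q ih =>
        intro hq
        have h1 := ih (by omega)
        have h2 := hle (q + 1) hq
        rw [Finset.sum_Icc_succ_top (by omega)]
        simp only [Nat.add_sub_cancel]
        omega
    have := htel p le_rfl
    omega
  have hmult := Nat.multinomial_spec (Finset.Icc 1 (p + 1)) fun m => e m - e (m - 1)
  rw [hsum] at hmult
  have hfac : 0 < ∏ m ∈ Finset.Icc 1 (p + 1), (e m - e (m - 1)).factorial :=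
    Finset.prod_pos fun m _ => Nat.factorial_pos _
  refine ⟨rfl, ?_, ?_⟩
  · refine Nat.eq_of_mul_eq_mul_right hfac ?_
    rw [hδ, ← hmult]
    ring
  · have hpos : 0 < ∏ m ∈ Finset.Icc 2 (p + 1), (e m - e (m - 1) - 1) := by
      refine Finset.prod_pos fun m hm => ?_
      rw [Finset.mem_Icc] at hm
      have := hgap (m - 1) (by omega) (by omega)
      rw [Nat.sub_add_cancel (by omega)] at this
      omega
    have hdvd : ∏ m ∈ Finset.Icc 2 (p + 1), (e m - e (m - 1) - 1) ∣
        ∏ m ∈ Finset.Icc 1 (p + 1), (e m - e (m - 1)).factorial := by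
      refine (Finset.prod_dvd_prod_of_dvd _ (fun m => (e m - e (m - 1)).factorial)
        fun m hm => ?_).trans
        (Finset.prod_dvd_prod_of_subset _ _ _ (Finset.Icc_subset_Icc_left (by omega)))
      rw [Finset.mem_Icc] at hm
      have := hgap (m - 1) (by omega) (by omega)
      rw [Nat.sub_add_cancel (by omega)] at this
      exact Nat.dvd_factorial (by omega) (Nat.sub_le _ _)
    obtain ⟨c, hc⟩ := hdvd
    refine ⟨c, Nat.eq_of_mul_eq_mul_right hpos ?_⟩
    rw [← hδ, hc]
    ring

end OneSidedCycleShuffles
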